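/- arXiv:2211.11712 — 3 statements merged into one kernel-verified Lean document; each statement's English description precedes it below -/
import Mathlib

section
/- Let (C^•, ∂) be a cochain complex of real vector spaces with C^k = 0 for k < 0 and with all cohomology spaces H^k(C) finite-dimensional, and let f be a chain map of degree 2 on C^•. Set b_k = dim H^k(C), r_k = rank([f] : H^k(C) → H^{k+2}(C)), and b_k^ω = dim H^k(Cone(f)). Then for every k ≥ 0, the alternating sum satisfies ∑_{i=0}^{k} (−1)^{k−i} b_i^ω = b_k − r_{k−1}. -/
noncomputable section

open Module

namespace ConeMorse

variable {C : ℤ → Type} [∀ k, AddCommGroup (C k)] [∀ k, Module ℝ (C k)]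

/-- Transport along an equality of degrees. -/
def lcast {i j : ℤ} (h : i = j) : C i →ₗ[ℝ] C j := by subst h; exact LinearMap.id

lemma lcast_lcast {i j m : ℤ} (h1 : i = j) (h2 : j = m) (x : C i) :
    lcast h2 (lcast h1 x) = lcast (h1.trans h2) x := by subst h1; subst h2; rfl

lemma apply_lcast {ℓ : ℤ} (g : ∀ k, C k →ₗ[ℝ] C (k + ℓ)) {i j : ℤ} (h : i = j) (x : C i) :
    g j (lcast h x) = lcast (show i + ℓ = j + ℓ by rw [h]) (g i x) := by subst h; rfl

@[simp] lemma lcast_zero {i j : ℤ} (h : i = j) : lcast (C := C) h (0 : C i) = 0 := map_zero _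

lemma lcast_eq_zero_iff {i j : ℤ} (h : i = j) (x : C i) : lcast h x = 0 ↔ x = 0 := by
  subst h; exact Iff.rfl

/-- The coboundary map `C^{k-1} → C^k` of the complex `(C, d)`. -/
def bmap (d : ∀ k, C k →ₗ[ℝ] C (k + 1)) (k : ℤ) : C (k - 1) →ₗ[ℝ] C k :=
  (lcast (show k - 1 + 1 = k by ring)).comp (d (k - 1))

/-- The degree `k` cohomology of the cochain complex `(C, d)`:
cocycles modulo coboundaries. -/
abbrev coho (C : ℤ → Type) [∀ k, AddCommGroup (C k)] [∀ k, Module ℝ (C k)]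
    (d : ∀ k, C k →ₗ[ℝ] C (k + 1)) (k : ℤ) : Type :=
  ↥(LinearMap.ker (d k)) ⧸
    (LinearMap.range (bmap d k)).comap (LinearMap.ker (d k)).subtype

/-- `f` is a chain map of degree `ℓ` on the complex `(C, d)`, i.e. `∂ ∘ f = f ∘ ∂`. -/
def IsChainMap (d : ∀ k, C k →ₗ[ℝ] C (k + 1)) {ℓ : ℤ}
    (f : ∀ k, C k →ₗ[ℝ] C (k + ℓ)) : Prop :=
  ∀ k, (d (k + ℓ)).comp (f k) =
    (lcast (show k + 1 + ℓ = k + ℓ + 1 by ring)).comp ((f (k + 1)).comp (d k))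

/-- The degree `k` piece of the cone of a degree `ℓ` map: `C^k ⊕ C^{k-ℓ+1}`. -/
abbrev coneX (C : ℤ → Type) (ℓ : ℤ) : ℤ → Type := fun k => C k × C (k - ℓ + 1)

/-- The cone differential `d_C (x, y) = (∂ x + f y, - ∂ y)`. -/
def coneD (d : ∀ k, C k →ₗ[ℝ] C (k + 1)) {ℓ : ℤ} (f : ∀ k, C k →ₗ[ℝ] C (k + ℓ)) (k : ℤ) :
    coneX C ℓ k →ₗ[ℝ] coneX C ℓ (k + 1) :=
  LinearMap.prod
    ((d k).comp (LinearMap.fst ℝ (C k) (C (k - ℓ + 1))) +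
      ((lcast (show k - ℓ + 1 + ℓ = k + 1 by ring)).comp (f (k - ℓ + 1))).comp
        (LinearMap.snd ℝ (C k) (C (k - ℓ + 1))))
    (-(((lcast (show k - ℓ + 1 + 1 = k + 1 - ℓ + 1 by ring)).comp (d (k - ℓ + 1))).comp
        (LinearMap.snd ℝ (C k) (C (k - ℓ + 1)))))



@[simp] lemma coneD_apply (d : ∀ k, C k →ₗ[ℝ] C (k + 1)) {ℓ : ℤ}
    (f : ∀ k, C k →ₗ[ℝ] C (k + ℓ)) (k : ℤ) (x : C k) (y : C (k - ℓ + 1)) :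
    coneD d f k (x, y)
      = (d k x + lcast (show k - ℓ + 1 + ℓ = k + 1 by ring) (f (k - ℓ + 1) y),
         -(lcast (show k - ℓ + 1 + 1 = k + 1 - ℓ + 1 by ring) (d (k - ℓ + 1) y))) := rfl

lemma bmap_apply (d : ∀ k, C k →ₗ[ℝ] C (k + 1)) (k : ℤ) (x : C (k - 1)) :
    bmap d k x = lcast (show k - 1 + 1 = k by ring) (d (k - 1) x) := rfl

/-- A chain map of degree `ℓ` maps cocycles to cocycles. -/
def cocycleMap (d : ∀ k, C k →ₗ[ℝ] C (k + 1)) {ℓ : ℤ} (f : ∀ k, C k →ₗ[ℝ] C (k + ℓ))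
    (hf : IsChainMap d f) (k : ℤ) :
    ↥(LinearMap.ker (d k)) →ₗ[ℝ] ↥(LinearMap.ker (d (k + ℓ))) :=
  (f k).restrict (fun x hx => by
    have h := LinearMap.congr_fun (hf k) x
    simp only [LinearMap.comp_apply] at h
    simp only [LinearMap.mem_ker] at hx ⊢
    rw [h, hx, map_zero, map_zero])

/-- The map induced by a degree `ℓ` chain map on cohomology. -/
def inducedMap (d : ∀ k, C k →ₗ[ℝ] C (k + 1)) {ℓ : ℤ} (f : ∀ k, C k →ₗ[ℝ] C (k + ℓ))
    (hf : IsChainMap d f) (k : ℤ) : coho C d k →ₗ[ℝ] coho C d (k + ℓ) :=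
  Submodule.mapQ _ _ (cocycleMap d f hf k) (by
    intro z hz
    simp only [Submodule.mem_comap, Submodule.coe_subtype, LinearMap.mem_range] at hz ⊢
    obtain ⟨y, hy⟩ := hz
    refine ⟨lcast (show k - 1 + ℓ = k + ℓ - 1 by ring) (f (k - 1) y), ?_⟩
    have hco : ((cocycleMap d f hf k z : ↥(LinearMap.ker (d (k + ℓ)))) : C (k + ℓ))
        = f k (z : C k) := rfl
    rw [hco, ← hy]
    show bmap d (k + ℓ) _ = f k (bmap d k y)
    unfold bmap
    simp only [LinearMap.comp_apply]
    rw [apply_lcast (ℓ := 1) d, apply_lcast f, lcast_lcast]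
    have h := LinearMap.congr_fun (hf (k - 1)) y
    simp only [LinearMap.comp_apply] at h
    rw [h, lcast_lcast])


/-- Identification of cohomology in equal degrees. -/
def cohoCast (d : ∀ k, C k →ₗ[ℝ] C (k + 1)) {i j : ℤ} (h : i = j) :
    coho C d i →ₗ[ℝ] coho C d j := by subst h; exact LinearMap.id

/-- The map `[f] : H^i(C) → H^j(C)` (with `j = i + ℓ`) induced on cohomology by a
degree `ℓ` chain map `f`. -/
def inducedMap' (d : ∀ k, C k →ₗ[ℝ] C (k + 1)) {ℓ : ℤ} (f : ∀ k, C k →ₗ[ℝ] C (k + ℓ))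
    (hf : IsChainMap d f) (i j : ℤ) (h : i + ℓ = j) : coho C d i →ₗ[ℝ] coho C d j :=
  (cohoCast d h).comp (inducedMap d f hf i)

lemma coneX_lcast {ℓ : ℤ} {i j : ℤ} (h : i = j) (x : C i) (y : C (i - ℓ + 1)) :
    lcast (C := coneX C ℓ) h (x, y)
      = (lcast h x, lcast (show i - ℓ + 1 = j - ℓ + 1 by rw [h]) y) := by
  subst h; rfl


/-- The map `[ι] : H^k(C) → H^k(Cone f)` induced by the inclusion `x ↦ (x, 0)`. -/
def inducedIota (d : ∀ k, C k →ₗ[ℝ] C (k + 1)) {ℓ : ℤ} (f : ∀ k, C k →ₗ[ℝ] C (k + ℓ))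
    (hf : IsChainMap d f) (k : ℤ) :
    coho C d k →ₗ[ℝ] coho (coneX C ℓ) (coneD d f) k :=
  Submodule.mapQ _ _ ((LinearMap.inl ℝ (C k) (C (k - ℓ + 1))).restrict (fun x hx => by
      simp only [LinearMap.mem_ker] at hx ⊢
      simp only [LinearMap.inl_apply]
      simp [coneD, hx, Prod.ext_iff]))
    (by
      intro z hz
      simp only [Submodule.mem_comap, Submodule.coe_subtype, LinearMap.mem_range] at hz ⊢
      obtain ⟨y, hy⟩ := hz
      refine ⟨(y, 0), ?_⟩
      show bmap (coneD d f) k (y, 0) = ((z : C k), (0 : C (k - ℓ + 1)))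
      have h1 : coneD d f (k - 1) (y, 0) = (d (k - 1) y, 0) := by
        simp [coneD, Prod.ext_iff]
      show lcast (C := coneX C ℓ) _ (coneD d f (k - 1) (y, 0)) = _
      rw [h1, coneX_lcast, ← hy]
      exact Prod.ext rfl (by simp))

/-- The map `[π] : H^k(Cone f) → H^{k-ℓ+1}(C)` induced by the projection `(x, y) ↦ y`. -/
def inducedPi (d : ∀ k, C k →ₗ[ℝ] C (k + 1)) {ℓ : ℤ} (f : ∀ k, C k →ₗ[ℝ] C (k + ℓ))
    (hf : IsChainMap d f) (k : ℤ) :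
    coho (coneX C ℓ) (coneD d f) k →ₗ[ℝ] coho C d (k - ℓ + 1) :=
  Submodule.mapQ _ _ ((LinearMap.snd ℝ (C k) (C (k - ℓ + 1))).restrict (fun x hx => by
      obtain ⟨x1, x2⟩ := x
      simp only [LinearMap.mem_ker] at hx ⊢
      have h2 := congrArg Prod.snd hx
      rw [coneD_apply] at h2
      simp only [Prod.snd_zero, neg_eq_zero, lcast_eq_zero_iff] at h2
      simpa using h2))
    (by
      intro z hz
      simp only [Submodule.mem_comap, Submodule.coe_subtype, LinearMap.mem_range] at hz ⊢
      obtain ⟨⟨w1, w2⟩, hw⟩ := hz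
      refine ⟨-(lcast (show k - 1 - ℓ + 1 = k - ℓ + 1 - 1 by ring) w2), ?_⟩
      have h2 := congrArg Prod.snd hw
      rw [bmap_apply, coneD_apply, coneX_lcast] at h2
      simp only [map_neg, lcast_lcast] at h2
      show bmap d (k - ℓ + 1) _ = ((z : coneX C ℓ k)).2
      rw [← h2, bmap_apply, map_neg, map_neg, apply_lcast (ℓ := 1) d, lcast_lcast])


lemma coho_mk_eq_zero (d : ∀ k, C k →ₗ[ℝ] C (k + 1)) (k : ℤ) (z : LinearMap.ker (d k)) :
    (Submodule.Quotient.mk z : coho C d k) = 0 ↔ ∃ y, bmap d k y = (z : C k) := by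
  rw [Submodule.Quotient.mk_eq_zero]
  simp

lemma coho_mk_eq (d : ∀ k, C k →ₗ[ℝ] C (k + 1)) (k : ℤ) (z w : LinearMap.ker (d k)) :
    (Submodule.Quotient.mk z : coho C d k) = Submodule.Quotient.mk w
      ↔ ∃ y, bmap d k y = (z : C k) - w := by
  rw [Submodule.Quotient.eq]
  simp

lemma chain_cocycle (d : ∀ k, C k →ₗ[ℝ] C (k + 1)) (f : ∀ k, C k →ₗ[ℝ] C (k + 2))
    (hf : IsChainMap d f) {i j : ℤ} (h : i + 2 = j) (z : C i) (hz : d i z = 0) :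
    d j (lcast h (f i z)) = 0 := by
  subst h
  exact (cocycleMap d f hf i ⟨z, hz⟩).2

lemma induced_mk (d : ∀ k, C k →ₗ[ℝ] C (k + 1)) (f : ∀ k, C k →ₗ[ℝ] C (k + 2))
    (hf : IsChainMap d f) {i j : ℤ} (h : i + 2 = j) (z : C i) (hz : z ∈ LinearMap.ker (d i)) :
    inducedMap' d f hf i j h (Submodule.Quotient.mk ⟨z, hz⟩)
      = Submodule.Quotient.mk ⟨lcast h (f i z), chain_cocycle d f hf h z hz⟩ := by
  subst h
  rfl

lemma finrank_induced (d : ∀ k, C k →ₗ[ℝ] C (k + 1)) (f : ∀ k, C k →ₗ[ℝ] C (k + 2))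
    (hf : IsChainMap d f) {i i' j j' : ℤ} (h : i + 2 = j) (h' : i' + 2 = j') (e : i = i') :
    finrank ℝ (LinearMap.range (inducedMap' d f hf i j h))
      = finrank ℝ (LinearMap.range (inducedMap' d f hf i' j' h')) := by
  subst h; subst e; subst h'; rfl

lemma ker_iota (d : ∀ k, C k →ₗ[ℝ] C (k + 1)) (f : ∀ k, C k →ₗ[ℝ] C (k + 2))
    (hf : IsChainMap d f) (k : ℤ) :
    LinearMap.ker (inducedIota d f hf k)
      = LinearMap.range (inducedMap' d f hf (k - 2) k (by ring)) := by
  ext q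
  obtain ⟨⟨z, hz⟩, rfl⟩ := Submodule.Quotient.mk_surjective _ q
  rw [LinearMap.mem_ker]
  refine (coho_mk_eq_zero (coneD d f) k _).trans ?_
  constructor
  · rintro ⟨⟨w1, w2⟩, hw⟩
    replace hw : bmap (coneD d f) k (w1, w2) = (z, 0) := hw
    rw [bmap_apply, coneD_apply, coneX_lcast, Prod.mk.injEq] at hw
    obtain ⟨ha, hb⟩ := hw
    simp only [map_neg, neg_eq_zero, lcast_eq_zero_iff] at hb
    refine ⟨Submodule.Quotient.mk ⟨lcast (show k - 1 - 2 + 1 = k - 2 by ring) w2, ?_⟩, ?_⟩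
    · rw [LinearMap.mem_ker, apply_lcast (ℓ := 1) d, hb, lcast_zero]
    · rw [induced_mk, coho_mk_eq]
      refine ⟨-w1, ?_⟩
      simp only [← ha, map_add, map_neg, bmap_apply, lcast_lcast, apply_lcast f]
      abel
  · rintro ⟨q, hq⟩
    obtain ⟨⟨w, hw⟩, rfl⟩ := Submodule.Quotient.mk_surjective _ q
    rw [induced_mk, coho_mk_eq] at hq
    obtain ⟨y, hy⟩ := hq
    refine ⟨(-y, lcast (show k - 2 = k - 1 - 2 + 1 by ring) w), ?_⟩
    change bmap (coneD d f) k _ = (z, 0)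
    rw [LinearMap.mem_ker] at hw
    rw [bmap_apply, coneD_apply, coneX_lcast, Prod.mk.injEq]
    rw [bmap_apply] at hy
    simp only [map_add, map_neg, lcast_lcast, apply_lcast f, apply_lcast (ℓ := 1) d, hw,
      lcast_zero, neg_zero, and_true] at hy ⊢
    rw [hy]; abel

lemma range_iota (d : ∀ k, C k →ₗ[ℝ] C (k + 1)) (f : ∀ k, C k →ₗ[ℝ] C (k + 2))
    (hf : IsChainMap d f) (k : ℤ) :
    LinearMap.range (inducedIota d f hf k) = LinearMap.ker (inducedPi d f hf k) := by
  ext q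
  constructor
  · rintro ⟨q, rfl⟩
    obtain ⟨⟨z, hz⟩, rfl⟩ := Submodule.Quotient.mk_surjective _ q
    rw [LinearMap.mem_ker]
    refine (coho_mk_eq_zero d _ _).2 ⟨0, ?_⟩
    rw [map_zero]; rfl
  · obtain ⟨⟨⟨x, y⟩, hz⟩, rfl⟩ := Submodule.Quotient.mk_surjective _ q
    intro h
    obtain ⟨u, hu⟩ := (coho_mk_eq_zero d _ _).1 (LinearMap.mem_ker.1 h)
    replace hu : bmap d (k - 2 + 1) u = y := hu
    have hz' := LinearMap.mem_ker.1 hz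
    rw [coneD_apply, Prod.mk_eq_zero] at hz'
    have hc := LinearMap.congr_fun (hf (k - 2 + 1 - 1)) u
    simp only [LinearMap.comp_apply] at hc
    have e : k - 2 + 1 - 1 + 2 = k := by ring
    refine ⟨Submodule.Quotient.mk ⟨x + lcast e (f _ u), ?_⟩, ?_⟩
    · rw [LinearMap.mem_ker, map_add, apply_lcast (ℓ := 1) d, hc, ← hz'.1, ← hu, bmap_apply]
      simp only [apply_lcast f, lcast_lcast]
    · refine (coho_mk_eq (coneD d f) k _ _).2 ?_
      refine ⟨(0, lcast (show k - 2 + 1 - 1 = k - 1 - 2 + 1 by ring) u), ?_⟩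
      change bmap (coneD d f) k _ = (x + lcast e (f _ u), 0) - (x, y)
      rw [bmap_apply, coneD_apply, coneX_lcast, Prod.mk_sub_mk, Prod.mk.injEq, ← hu, bmap_apply]
      simp only [map_zero, zero_add, map_neg, lcast_lcast, apply_lcast f, apply_lcast (ℓ := 1) d,
        zero_sub, add_sub_cancel_left, and_self]

lemma range_pi (d : ∀ k, C k →ₗ[ℝ] C (k + 1)) (f : ∀ k, C k →ₗ[ℝ] C (k + 2))
    (hf : IsChainMap d f) (k : ℤ) :
    LinearMap.range (inducedPi d f hf k)
      = LinearMap.ker (inducedMap' d f hf (k - 2 + 1) (k + 1) (by ring)) := by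
  ext q
  constructor
  · rintro ⟨q, rfl⟩
    obtain ⟨⟨⟨x, y⟩, hz⟩, rfl⟩ := Submodule.Quotient.mk_surjective _ q
    have hz' := LinearMap.mem_ker.1 hz
    rw [coneD_apply, Prod.mk_eq_zero] at hz'
    have hy : d _ y = 0 := by simpa [lcast_eq_zero_iff] using hz'.2
    rw [LinearMap.mem_ker]
    refine (induced_mk d f hf _ y hy).trans ?_
    refine (coho_mk_eq_zero d _ _).2 ⟨lcast (show k = k + 1 - 1 by ring) (-x), ?_⟩
    rw [bmap_apply, apply_lcast (ℓ := 1) d, lcast_lcast, map_neg, map_neg]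
    exact neg_eq_of_add_eq_zero_right hz'.1
  · obtain ⟨⟨y, hy⟩, rfl⟩ := Submodule.Quotient.mk_surjective _ q
    intro h
    rw [LinearMap.mem_ker, induced_mk, coho_mk_eq_zero] at h
    obtain ⟨x, hx⟩ := h
    rw [bmap_apply] at hx
    dsimp only at hx
    refine ⟨Submodule.Quotient.mk ⟨(-lcast (show k + 1 - 1 = k by ring) x, y), ?_⟩, rfl⟩
    rw [LinearMap.mem_ker] at hy ⊢
    rw [coneD_apply, hy, ← hx, map_neg, apply_lcast (ℓ := 1) d]
    simp

lemma finrank_cone (d : ∀ k, C k →ₗ[ℝ] C (k + 1)) (f : ∀ k, C k →ₗ[ℝ] C (k + 2))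
    (hf : IsChainMap d f) (hfin : ∀ k : ℤ, FiniteDimensional ℝ (coho C d k)) (k : ℤ) :
    (finrank ℝ (coho (coneX C 2) (coneD d f) k) : ℤ)
      = (finrank ℝ (coho C d k) - finrank ℝ (LinearMap.range
          (inducedMap' d f hf (k - 1) (k + 1) (by ring))))
        + (finrank ℝ (coho C d (k - 1)) - finrank ℝ (LinearMap.range
          (inducedMap' d f hf (k - 1 - 1) (k - 1 + 1) (by ring)))) := by
  have := hfin
  have h1 := LinearMap.finrank_range_add_finrank_ker (inducedIota d f hf k)
  have h3 := LinearMap.finrank_range_add_finrank_ker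
    (inducedMap' d f hf (k - 2 + 1) (k + 1) (by ring))
  have hK : Module.Finite ℝ (LinearMap.ker (inducedPi d f hf k)) := by
    rw [← range_iota]; infer_instance
  have : Module.Finite ℝ (coho (coneX C 2) (coneD d f) k) := by
    have e := (inducedPi d f hf k).quotKerEquivRange
    have : Module.Finite ℝ (coho (coneX C 2) (coneD d f) k ⧸ LinearMap.ker (inducedPi d f hf k)) :=
      Module.Finite.equiv e.symm
    exact Module.Finite.of_submodule_quotient (LinearMap.ker (inducedPi d f hf k))
  have h2 := LinearMap.finrank_range_add_finrank_ker (inducedPi d f hf k)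
  rw [ker_iota, range_iota] at h1
  rw [range_pi] at h2
  rw [finrank_induced d f hf (i' := k - 1 - 1) (j' := k - 1 + 1) _ (by ring) (by ring)] at h1
  rw [finrank_induced d f hf (i' := k - 1) (j' := k + 1) _ (by ring) (by ring)] at h3
  have e : k - 2 + 1 = k - 1 := by ring
  have h4 : finrank ℝ (coho C d (k - 2 + 1)) = finrank ℝ (coho C d (k - 1)) := by rw [e]
  omega

/-- If `C^k = 0` for `k < 0`, the cohomology of `(C, ∂)` is finite-dimensional
and `f` is a degree `2` chain map, then for every `k ≥ 0`,
`∑_{i=0}^{k} (-1)^{k-i} b_i^ω = b_k - r_{k-1}`, where `b_i^ω = dim H^i(Cone f)`,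
`b_k = dim H^k(C)` and `r_{k-1} = rank([f] : H^{k-1}(C) → H^{k+1}(C))`. -/
theorem cone_cohomology_alternating_sum_formula
    (C : ℤ → Type) [∀ k, AddCommGroup (C k)] [∀ k, Module ℝ (C k)]
    (hneg : ∀ k : ℤ, k < 0 → Subsingleton (C k))
    (d : ∀ k, C k →ₗ[ℝ] C (k + 1)) (hd : ∀ k, (d (k + 1)).comp (d k) = 0)
    (f : ∀ k, C k →ₗ[ℝ] C (k + 2)) (hf : IsChainMap d f)
    (hfin : ∀ k : ℤ, FiniteDimensional ℝ (coho C d k)) (k : ℕ) :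
    ∑ i ∈ Finset.range (k + 1),
        (-1 : ℤ) ^ (k - i) * (finrank ℝ (coho (coneX C 2) (coneD d f) (i : ℤ)) : ℤ)
      = (finrank ℝ (coho C d (k : ℤ)) : ℤ)
        - finrank ℝ ↥(LinearMap.range
            (inducedMap' d f hf ((k : ℤ) - 1) ((k : ℤ) + 1) (by ring))) := by
  have key := finrank_cone d f hf hfin
  have hz : ∀ m : ℤ, m < 0 → finrank ℝ (coho C d m) = 0 := by
    intro m hm
    have := hneg m hm
    have : Subsingleton (coho C d m) := (Submodule.Quotient.mk_surjective _).subsingleton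
    exact finrank_zero_of_subsingleton
  have hr : ∀ (m j : ℤ) (h : m + 2 = j), m < 0 →
      finrank ℝ (LinearMap.range (inducedMap' d f hf m j h)) = 0 := by
    intro m j h hm
    have := hfin
    have h1 := LinearMap.finrank_range_add_finrank_ker (inducedMap' d f hf m j h)
    have := hz m hm
    omega
  induction k with
  | zero =>
    have h0 := key 0
    rw [hz (0 - 1) (by norm_num), hr (0 - 1 - 1) _ _ (by norm_num)] at h0
    simpa using h0
  | succ n ih =>
    rw [Finset.sum_range_succ]
    have hs : ∑ i ∈ Finset.range (n + 1), (-1 : ℤ) ^ (n + 1 - i) *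
          (finrank ℝ (coho (coneX C 2) (coneD d f) (i : ℤ)) : ℤ)
        = - ∑ i ∈ Finset.range (n + 1), (-1 : ℤ) ^ (n - i) *
          (finrank ℝ (coho (coneX C 2) (coneD d f) (i : ℤ)) : ℤ) := by
      rw [← Finset.sum_neg_distrib]
      refine Finset.sum_congr rfl fun i hi => ?_
      rw [Finset.mem_range] at hi
      rw [show n + 1 - i = (n - i) + 1 by omega, pow_succ]
      ring
    have hk := key ((n + 1 : ℕ) : ℤ)
    have e : ((n + 1 : ℕ) : ℤ) - 1 = n := by push_cast; ring
    have h4 : finrank ℝ (coho C d (((n + 1 : ℕ) : ℤ) - 1)) = finrank ℝ (coho C d (n : ℤ)) := by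
      rw [e]
    rw [finrank_induced d f hf (i := ((n + 1 : ℕ) : ℤ) - 1 - 1) (i' := (n : ℤ) - 1)
      (j' := (n : ℤ) + 1) _ (by ring) (by rw [e]), h4] at hk
    rw [hs, ih, hk, Nat.sub_self, pow_zero]
    ring

end ConeMorse
end
end

section
/- (Weak cone Morse inequalities for general p.) Let p ≥ 0 be an integer, let (C^•, ∂) be a cochain complex of finite-dimensional real vector spaces, and let f be a chain map of degree 2p+2 on C^•, i.e. linear maps f : C^k → C^{k+2p+2} with ∂ ∘ f = f ∘ ∂. Form the cone complex Cone(f) with Cone(f)^k = C^k ⊕ C^{k−2p−1} and differential d_C(x, y) = (∂x + f y, −∂y). Set m_k = dim C^k, v_k = rank(f : C^k → C^{k+2p+2}), and s_k = dim H^k(Cone(f)). Then for every integer k, s_k ≤ m_k − v_{k−2p−2} + m_{k−2p−1} − v_{k−2p−1}. -/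
noncomputable section

open Module

namespace ConeMorse

variable {C : ℤ → Type} [∀ k, AddCommGroup (C k)] [∀ k, Module ℝ (C k)]

lemma finrank_coho_add {C : ℤ → Type} [∀ k, AddCommGroup (C k)] [∀ k, Module ℝ (C k)]
    [∀ k, FiniteDimensional ℝ (C k)]
    (d : ∀ k, C k →ₗ[ℝ] C (k + 1)) (hd : ∀ k, (d (k + 1)).comp (d k) = 0) (k : ℤ) :
    finrank ℝ (coho C d k) + finrank ℝ (LinearMap.range (d (k - 1)))
      + finrank ℝ (LinearMap.range (d k)) = finrank ℝ (C k) := by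
  have hle : LinearMap.range (bmap d k) ≤ LinearMap.ker (d k) := by
    rintro _ ⟨x, rfl⟩
    rw [LinearMap.mem_ker, bmap_apply, apply_lcast (ℓ := 1) d, lcast_eq_zero_iff]
    exact LinearMap.congr_fun (hd (k - 1)) x
  have h1 := Submodule.finrank_quotient_add_finrank
    ((LinearMap.range (bmap d k)).comap (LinearMap.ker (d k)).subtype)
  have h2 := (Submodule.comapSubtypeEquivOfLe hle).finrank_eq
  have h3 := LinearMap.finrank_range_add_finrank_ker (d k)
  have hk : LinearMap.ker (bmap d k) = LinearMap.ker (d (k - 1)) := by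
    ext x
    rw [LinearMap.mem_ker, LinearMap.mem_ker, bmap_apply, lcast_eq_zero_iff]
  have h4 := LinearMap.finrank_range_add_finrank_ker (d (k - 1))
  have h5 := LinearMap.finrank_range_add_finrank_ker (bmap d k)
  rw [hk] at h5
  have h6 : finrank ℝ (coho C d k) = finrank ℝ (↥(LinearMap.ker (d k)) ⧸
    (LinearMap.range (bmap d k)).comap (LinearMap.ker (d k)).subtype) := rfl
  omega

lemma coneD_comp {C : ℤ → Type} [∀ k, AddCommGroup (C k)] [∀ k, Module ℝ (C k)]
    (d : ∀ k, C k →ₗ[ℝ] C (k + 1)) (hd : ∀ k, (d (k + 1)).comp (d k) = 0) {ℓ : ℤ}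
    (f : ∀ k, C k →ₗ[ℝ] C (k + ℓ)) (hf : IsChainMap d f) (k : ℤ) :
    (coneD d f (k + 1)).comp (coneD d f k) = 0 := by
  have hdd : ∀ k x, d (k + 1) (d k x) = 0 := fun k x => LinearMap.congr_fun (hd k) x
  have hff : ∀ k x, d (k + ℓ) (f k x) = lcast (by ring) (f (k + 1) (d k x)) :=
    fun k x => LinearMap.congr_fun (hf k) x
  apply LinearMap.ext
  rintro ⟨x, y⟩
  rw [LinearMap.comp_apply, coneD_apply, coneD_apply]
  refine Prod.ext ?_ ?_
  · simp only [map_add, map_neg]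
    rw [hdd, apply_lcast (ℓ := 1) d, apply_lcast f, hff, lcast_lcast, lcast_lcast]
    simp
  · simp only [map_neg]
    rw [apply_lcast (ℓ := 1) d, hdd]
    simp

lemma rank_f_le {C : ℤ → Type} [∀ k, AddCommGroup (C k)] [∀ k, Module ℝ (C k)]
    [∀ k, FiniteDimensional ℝ (C k)]
    (d : ∀ k, C k →ₗ[ℝ] C (k + 1)) {ℓ : ℤ}
    (f : ∀ k, C k →ₗ[ℝ] C (k + ℓ)) (k j : ℤ) (h : k - ℓ + 1 = j) :
    finrank ℝ (LinearMap.range (f j)) ≤ finrank ℝ (LinearMap.range (coneD d f k)) := by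
  subst h
  have e : f (k - ℓ + 1) = ((lcast (C := C) (show k + 1 = k - ℓ + 1 + ℓ by ring)).comp
      (LinearMap.fst ℝ (C (k + 1)) (C (k + 1 - ℓ + 1)))).comp
      ((coneD d f k).comp (LinearMap.inr ℝ (C k) (C (k - ℓ + 1)))) := by
    ext y
    simp only [LinearMap.comp_apply, LinearMap.inr_apply, coneD_apply, LinearMap.fst_apply,
      map_zero, zero_add, lcast_lcast]
    rfl
  rw [e, LinearMap.range_comp]
  exact (Submodule.finrank_map_le _ _).trans
    (Submodule.finrank_mono (LinearMap.range_comp_le_range _ _))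

lemma finrank_C_cast {C : ℤ → Type} [∀ k, AddCommGroup (C k)] [∀ k, Module ℝ (C k)]
    {i j : ℤ} (h : i = j) : finrank ℝ (C i) = finrank ℝ (C j) := by subst h; rfl

/-- weak cone Morse inequalities for general `p`: for a degree `2p+2` chain
map `f` on a cochain complex of finite-dimensional real vector spaces, with cone
`Cone(f)^k = C^k ⊕ C^{k-2p-1}`, one has
`s_k ≤ m_k - v_{k-2p-2} + m_{k-2p-1} - v_{k-2p-1}` for every `k`, where `m_k = dim C^k`,
`v_k = rank(f : C^k → C^{k+2p+2})` and `s_k = dim H^k(Cone f)`. -/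
theorem weak_cone_morse_inequalities_general_p
    (p : ℕ)
    (C : ℤ → Type) [∀ k, AddCommGroup (C k)] [∀ k, Module ℝ (C k)]
    [∀ k, FiniteDimensional ℝ (C k)]
    (d : ∀ k, C k →ₗ[ℝ] C (k + 1)) (hd : ∀ k, (d (k + 1)).comp (d k) = 0)
    (f : ∀ k, C k →ₗ[ℝ] C (k + (2 * (p : ℤ) + 2))) (hf : IsChainMap d f) (k : ℤ) :
    (finrank ℝ (coho (coneX C (2 * (p : ℤ) + 2)) (coneD d f) k) : ℤ)
      ≤ (finrank ℝ (C k) : ℤ)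
        - finrank ℝ ↥(LinearMap.range (f (k - 2 * (p : ℤ) - 2)))
        + finrank ℝ (C (k - 2 * (p : ℤ) - 1))
        - finrank ℝ ↥(LinearMap.range (f (k - 2 * (p : ℤ) - 1))) := by
  have h1 := finrank_coho_add (coneD d f) (coneD_comp d hd f hf) k
  have h2 := rank_f_le d f k (k - 2 * (p : ℤ) - 1) (by ring)
  have h3 := rank_f_le d f (k - 1) (k - 2 * (p : ℤ) - 2) (by ring)
  have h4 : finrank ℝ (coneX C (2 * (p : ℤ) + 2) k) =
      finrank ℝ (C k) + finrank ℝ (C (k - (2 * (p : ℤ) + 2) + 1)) := Module.finrank_prod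
  have h5 := finrank_C_cast (C := C)
    (show k - (2 * (p : ℤ) + 2) + 1 = k - 2 * (p : ℤ) - 1 by ring)
  omega

end ConeMorse
end
end

section
/- (Strong cone Morse inequalities for general p.) Let p ≥ 0 be an integer, let (C^•, ∂) be a cochain complex of finite-dimensional real vector spaces with C^k = 0 for k < 0, and let f be a chain map of degree 2p+2 on C^•, i.e. linear maps f : C^k → C^{k+2p+2} with ∂ ∘ f = f ∘ ∂. Form the cone complex Cone(f) with Cone(f)^k = C^k ⊕ C^{k−2p−1} and differential d_C(x, y) = (∂x + f y, −∂y). Set m_k = dim C^k, v_k = rank(f : C^k → C^{k+2p+2}), and s_k = dim H^k(Cone(f)). Then for every k ≥ 0, ∑_{i=0}^{k} (−1)^{k−i} s_i ≤ (∑_{i=max(0, k−2p)}^{k} (−1)^{k−i} m_i) − v_{k−2p−1}. -/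
noncomputable section

open Module

namespace ConeMorse

variable {C : ℤ → Type} [∀ k, AddCommGroup (C k)] [∀ k, Module ℝ (C k)]

lemma aux_finrank_lcast {i j : ℤ} (h : i = j) (S : Submodule ℝ (C i)) :
    finrank ℝ (S.map (lcast (C := C) h)) = finrank ℝ S := by
  subst h
  have : lcast (C := C) (rfl : i = i) = LinearMap.id := rfl
  rw [this, Submodule.map_id]

lemma aux_finrank_bmap (d : ∀ k, C k →ₗ[ℝ] C (k + 1)) (k : ℤ) :
    finrank ℝ (LinearMap.range (bmap d k)) = finrank ℝ (LinearMap.range (d (k - 1))) := by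
  unfold bmap
  rw [LinearMap.range_comp, aux_finrank_lcast]

lemma aux_coho [∀ k, FiniteDimensional ℝ (C k)] (d : ∀ k, C k →ₗ[ℝ] C (k + 1))
    (hd : ∀ k x, d (k + 1) (d k x) = 0) (k : ℤ) :
    (finrank ℝ (coho C d k) : ℤ) = finrank ℝ (C k) - finrank ℝ (LinearMap.range (d k))
      - finrank ℝ (LinearMap.range (d (k - 1))) := by
  have h1 := Submodule.finrank_quotient_add_finrank
    ((LinearMap.range (bmap d k)).comap (LinearMap.ker (d k)).subtype)
  have h2 := LinearMap.finrank_range_add_finrank_ker (d k)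
  have hle : LinearMap.range (bmap d k) ≤ LinearMap.ker (d k) := by
    rintro _ ⟨x, rfl⟩
    rw [LinearMap.mem_ker, bmap_apply, apply_lcast (ℓ := 1) d, hd, lcast_zero]
  have h3 := (Submodule.comapSubtypeEquivOfLe hle).finrank_eq
  rw [aux_finrank_bmap] at h3
  have h4 : finrank ℝ (coho C d k) + finrank ℝ (LinearMap.range (d (k - 1)))
      = finrank ℝ (LinearMap.ker (d k)) := by rw [← h3]; exact h1
  omega

lemma aux_coneD (d : ∀ k, C k →ₗ[ℝ] C (k + 1)) (hd : ∀ k, (d (k + 1)).comp (d k) = 0)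
    {ℓ : ℤ} (f : ∀ k, C k →ₗ[ℝ] C (k + ℓ)) (hf : IsChainMap d f) (k : ℤ) (x : coneX C ℓ k) :
    coneD d f (k + 1) (coneD d f k x) = 0 := by
  obtain ⟨x, y⟩ := x
  have hd' : ∀ k x, d (k + 1) (d k x) = 0 := fun k x => LinearMap.congr_fun (hd k) x
  have h := LinearMap.congr_fun (hf (k - ℓ + 1)) y
  simp only [LinearMap.comp_apply] at h
  rw [coneD_apply, coneD_apply]
  simp only [map_add, map_neg, hd', apply_lcast (ℓ := 1) d, apply_lcast f, h, lcast_lcast]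
  simp

lemma aux_rank [∀ k, FiniteDimensional ℝ (C k)] (d : ∀ k, C k →ₗ[ℝ] C (k + 1))
    {ℓ : ℤ} (f : ∀ k, C k →ₗ[ℝ] C (k + ℓ)) (k j : ℤ) (hj : k - ℓ + 1 = j) :
    finrank ℝ (LinearMap.range (f j)) ≤ finrank ℝ (LinearMap.range (coneD d f k)) := by
  subst hj
  rw [← aux_finrank_lcast (show k - ℓ + 1 + ℓ = k + 1 by ring)]
  refine le_trans (Submodule.finrank_mono ?_)
    (Submodule.finrank_map_le (LinearMap.fst ℝ (C (k + 1)) (C (k + 1 - ℓ + 1))) _)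
  rintro _ ⟨_, ⟨y, rfl⟩, rfl⟩
  refine ⟨_, ⟨(0, y), rfl⟩, ?_⟩
  simp

lemma aux_alt (a : ℕ → ℤ) (k : ℕ) :
    ∑ i ∈ Finset.range (k + 1 + 1), (-1 : ℤ) ^ (k + 1 - i) * a i
      = a (k + 1) - ∑ i ∈ Finset.range (k + 1), (-1 : ℤ) ^ (k - i) * a i := by
  rw [Finset.sum_range_succ, sub_eq_add_neg, ← Finset.sum_neg_distrib, add_comm]
  congr 1
  · simp
  · refine Finset.sum_congr rfl fun i hi => ?_
    have := Finset.mem_range.1 hi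
    rw [show k + 1 - i = (k - i) + 1 by omega, pow_succ]
    ring

lemma aux_alt_Icc (m : ℤ → ℤ) (hm : ∀ i < 0, m i = 0) (p k : ℕ) :
    ∑ i ∈ Finset.Icc (k + 1 - 2 * p) (k + 1), (-1 : ℤ) ^ (k + 1 - i) * m i
      = m (k + 1 : ℕ) + m ((k : ℤ) - 2 * p)
        - ∑ i ∈ Finset.Icc (k - 2 * p) k, (-1 : ℤ) ^ (k - i) * m i := by
  have key : ∀ a, a ≤ k + 1 → ∑ i ∈ Finset.Icc a (k + 1), (-1 : ℤ) ^ (k + 1 - i) * m i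
      = m (k + 1 : ℕ) - ∑ i ∈ Finset.Icc a k, (-1 : ℤ) ^ (k - i) * m i := by
    intro a ha
    rw [Finset.sum_Icc_succ_top ha, sub_eq_add_neg, ← Finset.sum_neg_distrib, add_comm]
    congr 1
    · simp
    · refine Finset.sum_congr rfl fun i hi => ?_
      have := Finset.mem_Icc.1 hi
      rw [show k + 1 - i = (k - i) + 1 by omega, pow_succ]
      ring
  rw [key _ (by omega)]
  rcases lt_or_ge k (2 * p) with h | h
  · rw [hm ((k : ℤ) - 2 * p) (by omega), show k + 1 - 2 * p = 0 by omega,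
      show k - 2 * p = 0 by omega]
    ring
  · obtain ⟨q, rfl⟩ := Nat.exists_eq_add_of_le h
    rw [show 2 * p + q + 1 - 2 * p = q + 1 by omega, show 2 * p + q - 2 * p = q by omega,
      ← Finset.add_sum_Ioc_eq_sum_Icc (show q ≤ 2 * p + q by omega)]
    have e : Finset.Icc (q + 1) (2 * p + q) = Finset.Ioc q (2 * p + q) := by
      ext; simp only [Finset.mem_Icc, Finset.mem_Ioc]; omega
    rw [e, show 2 * p + q - q = 2 * p by omega, pow_mul]
    push_cast
    rw [show (2 * (p : ℤ) + q - 2 * p) = q by ring]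
    ring

lemma aux_main [∀ k, FiniteDimensional ℝ (C k)]
    (p : ℕ) (hneg : ∀ k : ℤ, k < 0 → Subsingleton (C k))
    (d : ∀ k, C k →ₗ[ℝ] C (k + 1)) (hd : ∀ k, (d (k + 1)).comp (d k) = 0)
    (f : ∀ k, C k →ₗ[ℝ] C (k + (2 * (p : ℤ) + 2))) (hf : IsChainMap d f) (k : ℕ) :
    ∑ i ∈ Finset.range (k + 1),
        (-1 : ℤ) ^ (k - i) *
          (finrank ℝ (coho (coneX C (2 * (p : ℤ) + 2)) (coneD d f) (i : ℤ)) : ℤ)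
      = (∑ i ∈ Finset.Icc (k - 2 * p) k,
          (-1 : ℤ) ^ (k - i) * (finrank ℝ (C (i : ℤ)) : ℤ))
        - finrank ℝ (LinearMap.range (coneD d f k)) := by
  have hm : ∀ i : ℤ, i < 0 → (fun i : ℤ => (finrank ℝ (C i) : ℤ)) i = 0 := by
    intro i hi
    have := hneg i hi
    simp [finrank_zero_of_subsingleton]
  have hs : ∀ i : ℤ, (finrank ℝ (coho (coneX C (2 * (p : ℤ) + 2)) (coneD d f) i) : ℤ)
      = finrank ℝ (C i) + finrank ℝ (C (i - 1 - 2 * p))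
        - finrank ℝ (LinearMap.range (coneD d f i))
        - finrank ℝ (LinearMap.range (coneD d f (i - 1))) := by
    intro i
    rw [aux_coho (C := coneX C (2 * (p : ℤ) + 2)) (coneD d f) (aux_coneD d hd f hf) i,
      Module.finrank_prod]
    have e : finrank ℝ (C (i - (2 * (p : ℤ) + 2) + 1)) = finrank ℝ (C (i - 1 - 2 * p)) := by
      rw [show i - (2 * (p : ℤ) + 2) + 1 = i - 1 - 2 * p by ring]
    rw [e]
    push_cast
    ring
  induction k with
  | zero =>
    have h1 := hs 0
    have h2 := hm (0 - 1 - 2 * p) (by omega)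
    have h3 : finrank ℝ (LinearMap.range (coneD d f (0 - 1))) = 0 := by
      have := hneg (0 - 1) (by omega)
      have := hneg (0 - 1 - (2 * (p : ℤ) + 2) + 1) (by omega)
      have h := LinearMap.finrank_range_le (coneD d f (0 - 1))
      have h' : finrank ℝ (coneX C (2 * (p : ℤ) + 2) (0 - 1)) = 0 := by
        rw [Module.finrank_prod, finrank_zero_of_subsingleton, finrank_zero_of_subsingleton]
      omega
    simp only at h2
    rw [h2, h3] at h1
    simp only [zero_add, Finset.sum_range_one, Nat.zero_sub, Finset.Icc_self,
      Finset.sum_singleton, pow_zero, one_mul]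
    have h4 : (finrank ℝ (coho (coneX C (2 * (p : ℤ) + 2)) (coneD d f) 0) : ℤ)
      = finrank ℝ (C 0) - finrank ℝ (LinearMap.range (coneD d f 0)) := by rw [h1]; simp
    exact h4
  | succ k ih =>
    rw [aux_alt (fun i : ℕ =>
      (finrank ℝ (coho (coneX C (2 * (p : ℤ) + 2)) (coneD d f) (i : ℤ)) : ℤ)), ih,
      aux_alt_Icc (fun i : ℤ => (finrank ℝ (C i) : ℤ)) hm]
    rw [hs, show ((k + 1 : ℕ) : ℤ) - 1 = k by push_cast; ring]
    ring

/-- strong cone Morse inequalities for general `p`: for a degree `2p+2` chain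
map `f` on a cochain complex of finite-dimensional real vector spaces vanishing in negative
degrees, with cone `Cone(f)^k = C^k ⊕ C^{k-2p-1}`, one has for every `k ≥ 0`
`∑_{i=0}^{k} (-1)^{k-i} s_i ≤ (∑_{i=max(0,k-2p)}^{k} (-1)^{k-i} m_i) - v_{k-2p-1}`, where
`m_k = dim C^k`, `v_k = rank(f : C^k → C^{k+2p+2})` and `s_k = dim H^k(Cone f)`. -/
theorem strong_cone_morse_inequalities_general_p
    (p : ℕ)
    (C : ℤ → Type) [∀ k, AddCommGroup (C k)] [∀ k, Module ℝ (C k)]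
    [∀ k, FiniteDimensional ℝ (C k)]
    (hneg : ∀ k : ℤ, k < 0 → Subsingleton (C k))
    (d : ∀ k, C k →ₗ[ℝ] C (k + 1)) (hd : ∀ k, (d (k + 1)).comp (d k) = 0)
    (f : ∀ k, C k →ₗ[ℝ] C (k + (2 * (p : ℤ) + 2))) (hf : IsChainMap d f) (k : ℕ) :
    ∑ i ∈ Finset.range (k + 1),
        (-1 : ℤ) ^ (k - i) *
          (finrank ℝ (coho (coneX C (2 * (p : ℤ) + 2)) (coneD d f) (i : ℤ)) : ℤ)
      ≤ (∑ i ∈ Finset.Icc (k - 2 * p) k,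
          (-1 : ℤ) ^ (k - i) * (finrank ℝ (C (i : ℤ)) : ℤ))
        - finrank ℝ ↥(LinearMap.range (f ((k : ℤ) - 2 * (p : ℤ) - 1))) := by
  rw [aux_main p hneg d hd f hf k]
  have := aux_rank d f (k : ℤ) ((k : ℤ) - 2 * (p : ℤ) - 1) (by ring)
  omega

end ConeMorse
end
end
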